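/- arXiv:1310.1773 — 2 statements merged into one kernel-verified Lean document; each statement's English description precedes it below -/
import Mathlib

section
/- Let R be a commutative ring, M an R-module, and let m < n be natural numbers. For any scalars a_1, …, a_m ∈ R and elements x_1, …, x_m, y_1, …, y_m ∈ M, the element τ = ∑_{j=1}^m a_j • (ι(x_j) * ι(y_j)) of the exterior algebra ⋀ M satisfies τ^n = 0. -/
theorem aux_sum_pow {A : Type*} [Ring A] (m : ℕ) (f : Fin m → A)
    (hc : ∀ i j, Commute (f i) (f j)) (hs : ∀ i, f i ^ 2 = 0) :
    (∑ j, f j) ^ (m + 1) = 0 := by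
  induction m with
  | zero => simp
  | succ m ih =>
    rw [Fin.sum_univ_succ]
    refine Commute.add_pow_eq_zero_of_add_le_succ_of_pow_eq_zero
      (Commute.sum_right _ _ _ fun j _ => hc _ _) (hs 0)
      (ih (fun j => f j.succ) (fun i j => hc _ _) (fun i => hs _)) (by omega)

theorem aux_swap {R : Type*} [CommRing R] {M : Type*}
    [AddCommGroup M] [Module R M] (x y : M) :
    ExteriorAlgebra.ι R x * ExteriorAlgebra.ι R y
      = -(ExteriorAlgebra.ι R y * ExteriorAlgebra.ι R x) :=
  eq_neg_of_add_eq_zero_left (ExteriorAlgebra.ι_add_mul_swap x y)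

theorem aux_commute {R : Type*} [CommRing R] {M : Type*}
    [AddCommGroup M] [Module R M] (x y z : M) :
    Commute (ExteriorAlgebra.ι R x * ExteriorAlgebra.ι R y) (ExteriorAlgebra.ι R z) := by
  unfold Commute SemiconjBy
  rw [mul_assoc, aux_swap y z, mul_neg, ← mul_assoc, aux_swap x z, neg_mul, neg_neg, mul_assoc]

/-- In the exterior algebra of a module `M` over a commutative ring `R`, an element
`τ = ∑_{j=1}^m a_j • (ι(x_j) * ι(y_j))` which is a sum of `m < n` decomposable degree-two
terms satisfies `τ^n = 0`. -/
theorem sum_smul_iota_mul_iota_pow_eq_zero {R : Type*} [CommRing R] {M : Type*}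
    [AddCommGroup M] [Module R M] (m n : ℕ) (hmn : m < n)
    (a : Fin m → R) (x y : Fin m → M) :
    (∑ j, a j • (ExteriorAlgebra.ι R (x j) * ExteriorAlgebra.ι R (y j))) ^ n = 0 := by
  refine pow_eq_zero_of_le (Nat.succ_le_of_lt hmn) (aux_sum_pow m _ (fun i j => ?_) fun i => ?_)
  · exact (((aux_commute _ _ _).mul_right (aux_commute _ _ _)).smul_left _).smul_right _
  · rw [smul_pow, pow_two (_ * _), ← mul_assoc, (aux_commute (x i) (y i) (x i)).eq, ← mul_assoc,
      ExteriorAlgebra.ι_sq_zero, zero_mul, zero_mul, smul_zero]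
end

section
/- Let n ≥ 1 and let b_1, c_1, …, b_n, c_n be 2n complex numbers that are algebraically independent over ℚ. Then the 2n-fold product ι(D b_1) * ι(D c_1) * ⋯ * ι(D b_n) * ι(D c_n) is nonzero in the exterior algebra of Ω¹_{ℂ/ℚ} over ℂ; equivalently, the wedge D b_1 ∧ D c_1 ∧ ⋯ ∧ D b_n ∧ D c_n is nonzero in ⋀^{2n} Ω¹_{ℂ/ℚ}. -/
open scoped TensorProduct in
/-- For a transcendence basis `x` of a characteristic zero field extension, the differentials
`D (x i)` are linearly independent. -/
lemma linearIndependent_D_of_isTranscendenceBasis {k L ι : Type} [Field k] [Field L] [CharZero k]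
    [Algebra k L] {x : ι → L} (hx : IsTranscendenceBasis k x) :
    LinearIndependent L fun i => KaehlerDifferential.D k L (x i) := by
  let alg : Algebra (MvPolynomial ι k) L := (MvPolynomial.aeval x).toAlgebra
  have hmap : ∀ p, algebraMap (MvPolynomial ι k) L p = MvPolynomial.aeval x p := fun _ => rfl
  have : IsScalarTower k (MvPolynomial ι k) L :=
    IsScalarTower.of_algebraMap_eq fun r => by simp [hmap]
  have : FaithfulSMul (MvPolynomial ι k) L :=
    (faithfulSMul_iff_algebraMap_injective _ _).2 hx.1
  have : Algebra.IsAlgebraic (MvPolynomial ι k) L := by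
    have h := hx.isAlgebraic
    constructor
    intro z
    obtain ⟨p, hp, hz⟩ := h.isAlgebraic z
    refine ⟨p.map (hx.1.aevalEquiv.symm : _ →+* MvPolynomial ι k), ?_, ?_⟩
    · exact (Polynomial.map_ne_zero_iff hx.1.aevalEquiv.symm.injective).2 hp
    · rw [Polynomial.aeval_def, Polynomial.eval₂_map]
      rw [Polynomial.aeval_def] at hz
      convert! hz using 2
      ext a
      obtain ⟨q, rfl⟩ := hx.1.aevalEquiv.surjective a
      simp [hmap]
  let : Algebra (FractionRing (MvPolynomial ι k)) L := FractionRing.liftAlgebra _ _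
  have : Algebra.IsAlgebraic (FractionRing (MvPolynomial ι k)) L :=
    (IsFractionRing.comap_isAlgebraic_iff (A := MvPolynomial ι k)).1 inferInstance
  have : CharZero (FractionRing (MvPolynomial ι k)) :=
    charZero_of_injective_algebraMap (algebraMap k _).injective
  have : Algebra.FormallyEtale (FractionRing (MvPolynomial ι k)) L :=
    Algebra.FormallyEtale.of_isSeparable _ L
  have : Algebra.FormallyEtale (MvPolynomial ι k) (FractionRing (MvPolynomial ι k)) :=
    .of_isLocalization (nonZeroDivisors _)
  have : Algebra.FormallyEtale (MvPolynomial ι k) L :=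
    .comp _ (FractionRing (MvPolynomial ι k)) _
  let B := ((KaehlerDifferential.mvPolynomialBasis k ι).baseChange L).map
    (KaehlerDifferential.tensorKaehlerEquivOfFormallyEtale k (MvPolynomial ι k) L)
  convert! B.linearIndependent using 2 with i
  simp [B, KaehlerDifferential.mvPolynomialBasis_apply, hmap]

lemma linearIndependent_D_of_algebraicIndependent {k L ι : Type} [Field k] [Field L] [CharZero k]
    [Algebra k L] {x : ι → L} (hx : AlgebraicIndependent k x) :
    LinearIndependent L fun i => KaehlerDifferential.D k L (x i) := by
  obtain ⟨t, ht, hb⟩ := exists_isTranscendenceBasis_superset hx.coe_range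
  have h := linearIndependent_D_of_isTranscendenceBasis hb
  exact h.comp (fun i => (⟨x i, ht ⟨i, rfl⟩⟩ : t))
    fun i j hij => hx.injective (congrArg Subtype.val hij)

lemma ιMulti_ne_zero_of_linearIndependent {K V : Type*} [Field K] [AddCommGroup V] [Module K V]
    {m : ℕ} {u : Fin m → V} (hu : LinearIndependent K u) :
    ExteriorAlgebra.ιMulti K m u ≠ 0 := by
  classical
  intro h0
  obtain ⟨f, hf⟩ := (Fintype.linearCombination K u).exists_leftInverse_of_injective
    (LinearMap.ker_eq_bot.2 (linearIndependent_iff_injective_fintypeLinearCombination.1 hu))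
  have hfu : ∀ i, f (u i) = Pi.single i 1 := fun i => by
    have := LinearMap.congr_fun hf (Pi.single i 1)
    simpa [Fintype.linearCombination_apply_single] using this
  let F : ∀ i, V [⋀^Fin i]→ₗ[K] K := fun i =>
    if h : i = m then h ▸ (Matrix.detRowAlternating.compLinearMap f) else 0
  have h1 := ExteriorAlgebra.liftAlternating_apply_ιMulti F u
  rw [h0, map_zero] at h1
  have h2 : F m u = 1 := by
    have : (fun i => f (u i)) = (1 : Matrix (Fin m) (Fin m) K) := by
      funext i j
      rw [hfu, Matrix.one_apply, Pi.single_apply]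
      simp [eq_comm]
    simp only [F, dite_true, AlternatingMap.compLinearMap_apply]
    change Matrix.det (fun i => f (u i)) = 1
    rw [this, Matrix.det_one]
  exact zero_ne_one (h1.trans h2)

/-- If `b_1, c_1, …, b_n, c_n` are `2n` complex numbers which are algebraically independent
over `ℚ`, then the wedge `D b_1 ∧ D c_1 ∧ ⋯ ∧ D b_n ∧ D c_n`, i.e. the `2n`-fold product
`ι(D b_1) * ι(D c_1) * ⋯ * ι(D b_n) * ι(D c_n)`, is nonzero in the exterior algebra of
`Ω¹_{ℂ/ℚ}` over `ℂ`. -/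
theorem wedge_D_ne_zero_of_algebraicIndependent (n : ℕ) (hn : 1 ≤ n) (b c : Fin n → ℂ)
    (hind : AlgebraicIndependent ℚ (Sum.elim b c)) :
    (List.ofFn fun i : Fin n =>
        ExteriorAlgebra.ι ℂ (KaehlerDifferential.D ℚ ℂ (b i)) *
          ExteriorAlgebra.ι ℂ (KaehlerDifferential.D ℚ ℂ (c i))).prod ≠ 0 := by
  classical
  have hli := linearIndependent_D_of_algebraicIndependent hind
  let e : Fin (n * 2) → Fin n ⊕ Fin n := fun k =>
    if k.modNat = 0 then Sum.inl k.divNat else Sum.inr k.divNat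
  have he : Function.Injective e := by
    intro k l hkl
    apply finProdFinEquiv.symm.injective
    have hk : k.modNat = 0 ∨ k.modNat = 1 := by omega
    have hl : l.modNat = 0 ∨ l.modNat = 1 := by omega
    simp only [finProdFinEquiv_symm_apply, Prod.mk.injEq]
    rcases hk with hk | hk <;> rcases hl with hl | hl <;> simp_all [e]
  have key := ιMulti_ne_zero_of_linearIndependent (hli.comp e he)
  rw [ExteriorAlgebra.ιMulti_apply, List.ofFn_mul, List.prod_flatten, List.map_ofFn] at key
  convert! key using 4 with i
  have h0 : e ⟨i * 2, by omega⟩ = Sum.inl i := by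
    simp [e, Fin.modNat, Fin.divNat, Fin.ext_iff]
  have h1 : e ⟨i * 2 + 1, by omega⟩ = Sum.inr i := by
    have : (i * 2 + 1 : ℕ) / 2 = i := by omega
    simp [e, Fin.modNat, Fin.divNat, Fin.ext_iff, this]
  simp [List.ofFn_succ, h0, h1]
end
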